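/- arXiv:1111.5899 — 2 statements merged into one kernel-verified Lean document; each statement's English description precedes it below -/
import Mathlib

section
/- Let S ⊂ V(G) and n ∈ ℕ, n ≥ 1, be such that the vertex boundary b(cl^{n−1}(S)) is not empty. Then for every f ∈ L₂(G): (Σ_{v∈cl^n(S)} |f(v)|²)^{1/2} ≤ (∏_{i=0}^{n−1} (2·D_i/K_i + 1))^{1/2} · (Σ_{v∈S} |f(v)|²)^{1/2} + 2·(Σ_{j=0}^{n−1} (1/K_j)·∏_{i=j+1}^{n−1} (2·D_i/K_i + 1))^{1/2} · ‖L^{1/2} f‖. In particular, if cl^n(S) = V(G), then ‖f‖ ≤ (∏_{i=0}^{n−1} (2·D_i/K_i + 1))^{1/2} · (Σ_{v∈S} |f(v)|²)^{1/2} + 2·(Σ_{j=0}^{n−1} (1/K_j)·∏_{i=j+1}^{n−1} (2·D_i/K_i + 1))^{1/2} · ‖L^{1/2} f‖. -/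
open scoped BigOperators

variable {V : Type*}

noncomputable def lapl (G : SimpleGraph V) [DecidableRel G.Adj] [G.LocallyFinite]
    (f : V → ℂ) (v : V) : ℂ :=
  ∑ u ∈ G.neighborFinset v, (f v - f u)

noncomputable def l2norm (f : V → ℂ) : ℝ :=
  Real.sqrt (∑' v, ‖f v‖ ^ 2)

noncomputable def dirichlet (G : SimpleGraph V) [DecidableRel G.Adj] [G.LocallyFinite]
    (f : V → ℂ) : ℝ :=
  (∑' v, lapl G f v * (starRingEnd ℂ) (f v)).re

def bdry (G : SimpleGraph V) (S : Set V) : Set V :=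
  {v | v ∉ S ∧ ∃ u ∈ S, G.Adj u v}

def cl (G : SimpleGraph V) (S : Set V) : Set V := S ∪ bdry G S

/-- `D_m(S) = sup_{v ∈ cl^m(S)} d_m(v)` where `d_m(v)` is the number of vertices of
`b(cl^m(S))` adjacent to `v`. -/
noncomputable def Dm (G : SimpleGraph V) (S : Set V) (m : ℕ) : ℕ :=
  sSup ((fun v => {w | w ∈ bdry G ((cl G)^[m] S) ∧ G.Adj v w}.ncard) '' ((cl G)^[m] S))

/-- `K_m(S) = inf_{v ∈ b(cl^m(S))} k_m(v)` where `k_m(v)` is the number of vertices of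
`cl^m(S)` adjacent to `v`. -/
noncomputable def Km (G : SimpleGraph V) (S : Set V) (m : ℕ) : ℕ :=
  sInf ((fun v => {w | w ∈ (cl G)^[m] S ∧ G.Adj v w}.ncard) '' bdry G ((cl G)^[m] S))

theorem hasSum_indicator_const {α : Type*} {s : Set α} (hs : s.Finite) (c : ℝ) :
    HasSum (s.indicator fun _ => c) (s.ncard * c) := by
  have h := hasSum_sum_of_ne_finset_zero (L := .unconditional _) (f := s.indicator fun _ => c) (s := hs.toFinset)
    (fun b hb => Set.indicator_of_notMem (by simpa using hb) _)
  convert h using 1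
  rw [Finset.sum_congr rfl (fun x hx => Set.indicator_of_mem (hs.mem_toFinset.1 hx) _)]
  simp [Set.ncard_eq_toFinset_card s hs]

theorem sqrt_add_le_add_sqrt (a b : ℝ) : Real.sqrt (a + b) ≤ Real.sqrt a + Real.sqrt b := by
  have le_sq_sqrt : ∀ x : ℝ, x ≤ Real.sqrt x ^ 2 := fun x => (Real.sqrt_le_iff.1 le_rfl).2
  refine Real.sqrt_le_iff.2 ⟨by positivity, ?_⟩
  nlinarith [le_sq_sqrt a, le_sq_sqrt b, mul_nonneg (Real.sqrt_nonneg a) (Real.sqrt_nonneg b)]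

section EdgeSums

variable {G : SimpleGraph V} {φ : V → ℝ} {E : Set (V × V)} {D : ℕ}

theorem finite_edge_fiber [G.LocallyFinite] (hE : ∀ p ∈ E, G.Adj p.1 p.2) (v : V) :
    {u | (v, u) ∈ E}.Finite :=
  (G.neighborSet v).toFinite.subset fun _ hu => hE _ hu

theorem hasSum_edge_fiber [G.LocallyFinite] (hE : ∀ p ∈ E, G.Adj p.1 p.2) (v : V) :
    HasSum (fun u => E.indicator (fun p => φ p.1) (v, u)) ({u | (v, u) ∈ E}.ncard * φ v) :=
  hasSum_indicator_const (finite_edge_fiber hE v) (φ v)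

theorem ncard_edge_fiber_le [G.LocallyFinite] (hD : ∀ v, G.degree v ≤ D)
    (hE : ∀ p ∈ E, G.Adj p.1 p.2) (v : V) : {u | (v, u) ∈ E}.ncard ≤ D := by
  refine le_trans (Set.ncard_le_ncard (t := G.neighborSet v) (fun _ hu => hE _ hu)
    (G.neighborSet v).toFinite) ?_
  rw [Set.ncard_eq_toFinset_card', ← SimpleGraph.neighborFinset_def]
  exact hD v

theorem summable_ncard_mul [G.LocallyFinite] (hD : ∀ v, G.degree v ≤ D) (hφ : Summable φ)
    (h0 : ∀ v, 0 ≤ φ v) (hE : ∀ p ∈ E, G.Adj p.1 p.2) :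
    Summable fun v => ({u | (v, u) ∈ E}.ncard : ℝ) * φ v :=
  Summable.of_nonneg_of_le (fun v => mul_nonneg (Nat.cast_nonneg _) (h0 v))
    (fun v => mul_le_mul_of_nonneg_right
      (by exact_mod_cast ncard_edge_fiber_le hD hE v) (h0 v)) (hφ.mul_left (D : ℝ))

theorem summable_edge_fst [G.LocallyFinite] (hD : ∀ v, G.degree v ≤ D) (hφ : Summable φ)
    (h0 : ∀ v, 0 ≤ φ v) (hE : ∀ p ∈ E, G.Adj p.1 p.2) :
    Summable (E.indicator fun p => φ p.1) := by
  refine (summable_prod_of_nonneg fun p => Set.indicator_nonneg (fun p _ => h0 p.1) p).2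
    ⟨fun v => (hasSum_edge_fiber hE v).summable, ?_⟩
  simp only [(hasSum_edge_fiber hE _).tsum_eq]
  exact summable_ncard_mul hD hφ h0 hE

theorem tsum_edge_fst [G.LocallyFinite] (hD : ∀ v, G.degree v ≤ D) (hφ : Summable φ)
    (h0 : ∀ v, 0 ≤ φ v) (hE : ∀ p ∈ E, G.Adj p.1 p.2) :
    ∑' p, E.indicator (fun p => φ p.1) p = ∑' v, ({u | (v, u) ∈ E}.ncard : ℝ) * φ v := by
  rw [(summable_edge_fst hD hφ h0 hE).tsum_prod]
  simp only [(hasSum_edge_fiber hE _).tsum_eq]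

theorem indicator_snd_eq :
    (E.indicator fun p => φ p.2) =
      ((Prod.swap ⁻¹' E).indicator fun p => φ p.1) ∘ Equiv.prodComm V V := by
  ext ⟨v, u⟩
  simp [Set.indicator, Set.mem_preimage]
  rfl

theorem adj_of_mem_swap (hE : ∀ p ∈ E, G.Adj p.1 p.2) :
    ∀ p ∈ Prod.swap ⁻¹' E, G.Adj p.1 p.2 :=
  fun _ hp => (hE _ hp).symm

theorem summable_edge_snd [G.LocallyFinite] (hD : ∀ v, G.degree v ≤ D) (hφ : Summable φ)
    (h0 : ∀ v, 0 ≤ φ v) (hE : ∀ p ∈ E, G.Adj p.1 p.2) :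
    Summable (E.indicator fun p => φ p.2) := by
  rw [indicator_snd_eq]
  exact (Equiv.prodComm V V).summable_iff.2 (summable_edge_fst hD hφ h0 (adj_of_mem_swap hE))

theorem tsum_edge_snd [G.LocallyFinite] (hD : ∀ v, G.degree v ≤ D) (hφ : Summable φ)
    (h0 : ∀ v, 0 ≤ φ v) (hE : ∀ p ∈ E, G.Adj p.1 p.2) :
    ∑' p, E.indicator (fun p => φ p.2) p = ∑' u, ({v | (v, u) ∈ E}.ncard : ℝ) * φ u := by
  rw [indicator_snd_eq]
  exact ((Equiv.prodComm V V).tsum_eq _).trans (tsum_edge_fst hD hφ h0 (adj_of_mem_swap hE))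

end EdgeSums

/-- The sum of `‖f v - f u‖ ^ 2` over ordered adjacent pairs, i.e. twice the edge energy. -/
noncomputable def pairEnergy (G : SimpleGraph V) (f : V → ℂ) : ℝ :=
  ∑' p : V × V, {p : V × V | G.Adj p.1 p.2}.indicator (fun p => ‖f p.1 - f p.2‖ ^ 2) p

theorem norm_sq_sub_le (a b : ℂ) : ‖a - b‖ ^ 2 ≤ 2 * ‖a‖ ^ 2 + 2 * ‖b‖ ^ 2 := by
  nlinarith [norm_sub_le a b, norm_nonneg (a - b), sq_nonneg (‖a‖ - ‖b‖), norm_nonneg a,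
    norm_nonneg b]

theorem norm_sq_le_add_sub (a b : ℂ) : ‖a‖ ^ 2 ≤ 2 * ‖b‖ ^ 2 + 2 * ‖a - b‖ ^ 2 := by
  have h := norm_sq_sub_le b (b - a)
  rwa [sub_sub_cancel, norm_sub_rev b a] at h

theorem Km_le {G : SimpleGraph V} {S : Set V} {m : ℕ} {v : V} (hv : v ∈ bdry G ((cl G)^[m] S)) :
    Km G S m ≤ {w | w ∈ (cl G)^[m] S ∧ G.Adj v w}.ncard :=
  Nat.sInf_le ⟨v, hv, rfl⟩

section Energy

variable {G : SimpleGraph V} [G.LocallyFinite] {f : V → ℂ} {D : ℕ} {E : Set (V × V)}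

theorem summable_edge_diff (hD : ∀ v, G.degree v ≤ D) (hf : Summable fun v => ‖f v‖ ^ 2)
    (hE : ∀ p ∈ E, G.Adj p.1 p.2) :
    Summable (E.indicator fun p => ‖f p.1 - f p.2‖ ^ 2) := by
  have h1 := summable_edge_fst hD hf (fun v => by positivity) hE
  have h2 := summable_edge_snd hD hf (fun v => by positivity) hE
  refine Summable.of_nonneg_of_le
    (fun p => Set.indicator_nonneg (fun p _ => by positivity) p) (fun p => ?_)
    ((h1.mul_left 2).add (h2.mul_left 2))
  by_cases hp : p ∈ E
  · simpa [hp] using norm_sq_sub_le (f p.1) (f p.2)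
  · simp [hp]

theorem re_sub_mul_conj (a b : ℂ) :
    ((a - b) * (starRingEnd ℂ) a).re = (‖a - b‖ ^ 2 + ‖a‖ ^ 2 - ‖b‖ ^ 2) / 2 := by
  simp only [← Complex.normSq_eq_norm_sq, Complex.normSq_apply, Complex.mul_re, Complex.sub_re,
    Complex.sub_im, Complex.conj_re, Complex.conj_im]
  ring

theorem pairEnergy_eq_two_mul_dirichlet [DecidableRel G.Adj] (hD : ∀ v, G.degree v ≤ D)
    (hf : Summable fun v => ‖f v‖ ^ 2) : pairEnergy G f = 2 * dirichlet G f := by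
  set A : Set (V × V) := {p | G.Adj p.1 p.2} with hA
  have hE : ∀ p ∈ A, G.Adj p.1 p.2 := fun p hp => hp
  have h1 := summable_edge_fst hD hf (fun v => by positivity) hE
  have h2 := summable_edge_snd hD hf (fun v => by positivity) hE
  have h3 := summable_edge_diff hD hf hE
  have hc : Summable (A.indicator fun p => (f p.1 - f p.2) * (starRingEnd ℂ) (f p.1)) := by
    refine Summable.of_norm_bounded (h3.add h1) fun p => ?_
    by_cases hp : p ∈ A
    · simp only [hp, Set.indicator_of_mem, norm_mul, RCLike.norm_conj]
      nlinarith [sq_nonneg (‖f p.1 - f p.2‖ - ‖f p.1‖), sq_nonneg ‖f p.1 - f p.2‖,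
        sq_nonneg ‖f p.1‖]
    · simp [hp]
  have hrow : ∀ v, lapl G f v * (starRingEnd ℂ) (f v) =
      ∑' u, A.indicator (fun p => (f p.1 - f p.2) * (starRingEnd ℂ) (f p.1)) (v, u) := by
    intro v
    rw [tsum_eq_sum (s := G.neighborFinset v)
      (fun u hu => Set.indicator_of_notMem (by simpa [hA] using hu) _), lapl, Finset.sum_mul]
    refine Finset.sum_congr rfl fun u hu => ?_
    rw [Set.indicator_of_mem (by simpa [hA] using hu)]
  have hswap : ∑' p, A.indicator (fun p => ‖f p.1‖ ^ 2) p =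
      ∑' p, A.indicator (fun p => ‖f p.2‖ ^ 2) p := by
    rw [tsum_edge_fst (φ := fun v => ‖f v‖ ^ 2) hD hf (fun v => by positivity) hE,
      tsum_edge_snd (φ := fun v => ‖f v‖ ^ 2) hD hf (fun v => by positivity) hE]
    simp only [hA, Set.mem_ofPred_eq, G.adj_comm]
  have hre : ∀ p, (A.indicator (fun p => (f p.1 - f p.2) * (starRingEnd ℂ) (f p.1)) p).re =
      (A.indicator (fun p => ‖f p.1 - f p.2‖ ^ 2) p + A.indicator (fun p => ‖f p.1‖ ^ 2) p
        - A.indicator (fun p => ‖f p.2‖ ^ 2) p) / 2 := by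
    intro p
    by_cases hp : p ∈ A
    · simp only [hp, Set.indicator_of_mem, re_sub_mul_conj]
    · simp [hp]
  rw [dirichlet, tsum_congr hrow, ← hc.tsum_prod, Complex.re_tsum hc, tsum_congr hre,
    tsum_div_const, (h3.add h1).tsum_sub h2, h3.tsum_add h1, hswap, pairEnergy]
  ring

theorem tsum_edge_diff_le_pairEnergy (hD : ∀ v, G.degree v ≤ D)
    (hf : Summable fun v => ‖f v‖ ^ 2) (hE : ∀ p ∈ E, G.Adj p.1 p.2) :
    ∑' p, E.indicator (fun p => ‖f p.1 - f p.2‖ ^ 2) p ≤ pairEnergy G f :=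
  (summable_edge_diff hD hf hE).tsum_le_tsum
    (fun p => Set.indicator_le_indicator_of_subset (fun p hp => hE p hp)
      (fun _ => by positivity) p)
    (summable_edge_diff hD hf fun _ hp => hp)

/-- A boundary estimate with explicit constants: if every vertex of `B` has at least `k` neighbours
in `T` and every vertex of `T` has at most `d` neighbours in `B`, then the mass of `f` on `B` is
controlled by its mass on `T` and its energy. -/
theorem mul_tsum_indicator_le (hD : ∀ v, G.degree v ≤ D) (hf : Summable fun v => ‖f v‖ ^ 2)
    {T B : Set V} {k d : ℕ} (hk : ∀ v ∈ B, k ≤ {w | w ∈ T ∧ G.Adj v w}.ncard)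
    (hd : ∀ v ∈ T, {w | w ∈ B ∧ G.Adj v w}.ncard ≤ d) :
    (k : ℝ) * ∑' v, B.indicator (fun v => ‖f v‖ ^ 2) v ≤
      2 * d * ∑' v, T.indicator (fun v => ‖f v‖ ^ 2) v + 2 * pairEnergy G f := by
  set E : Set (V × V) := {p | p.1 ∈ B ∧ p.2 ∈ T ∧ G.Adj p.1 p.2} with hEdef
  have hE : ∀ p ∈ E, G.Adj p.1 p.2 := fun p hp => hp.2.2
  have h0 : ∀ v, 0 ≤ ‖f v‖ ^ 2 := fun v => by positivity
  have h1 := summable_edge_fst hD hf h0 hE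
  have h2 := summable_edge_snd hD hf h0 hE
  have h3 := summable_edge_diff hD hf hE
  have hlow : (k : ℝ) * ∑' v, B.indicator (fun v => ‖f v‖ ^ 2) v ≤
      ∑' p, E.indicator (fun p => ‖f p.1‖ ^ 2) p := by
    rw [tsum_edge_fst (φ := fun v => ‖f v‖ ^ 2) hD hf h0 hE, ← tsum_mul_left]
    refine ((hf.indicator B).mul_left (k : ℝ)).tsum_le_tsum (fun v => ?_)
      (summable_ncard_mul hD hf h0 hE)
    by_cases hv : v ∈ B
    · rw [Set.indicator_of_mem hv]
      refine mul_le_mul_of_nonneg_right ?_ (h0 v)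
      have := hk v hv
      simpa [hEdef, hv] using this
    · rw [Set.indicator_of_notMem hv]
      simpa using mul_nonneg (Nat.cast_nonneg _) (h0 v)
  have hup : ∑' p, E.indicator (fun p => ‖f p.2‖ ^ 2) p ≤
      d * ∑' v, T.indicator (fun v => ‖f v‖ ^ 2) v := by
    rw [tsum_edge_snd (φ := fun v => ‖f v‖ ^ 2) hD hf h0 hE, ← tsum_mul_left]
    refine (summable_ncard_mul hD hf h0 (adj_of_mem_swap hE)).tsum_le_tsum (fun v => ?_)
      ((hf.indicator T).mul_left (d : ℝ))
    by_cases hv : v ∈ T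
    · rw [Set.indicator_of_mem hv]
      refine mul_le_mul_of_nonneg_right ?_ (h0 v)
      have := hd v hv
      simpa [hEdef, hv, G.adj_comm] using this
    · simp [hEdef, hv]
  have hmid : ∑' p, E.indicator (fun p => ‖f p.1‖ ^ 2) p ≤
      2 * ∑' p, E.indicator (fun p => ‖f p.2‖ ^ 2) p +
        2 * ∑' p, E.indicator (fun p => ‖f p.1 - f p.2‖ ^ 2) p := by
    rw [← tsum_mul_left, ← tsum_mul_left, ← (h2.mul_left 2).tsum_add (h3.mul_left 2)]
    refine h1.tsum_le_tsum (fun p => ?_) ((h2.mul_left 2).add (h3.mul_left 2))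
    by_cases hp : p ∈ E
    · simpa [hp] using norm_sq_le_add_sub (f p.1) (f p.2)
    · simp [hp]
  have := tsum_edge_diff_le_pairEnergy hD hf hE
  linarith

theorem Km_pos {S : Set V} {m : ℕ} (h : (bdry G ((cl G)^[m] S)).Nonempty) : 0 < Km G S m := by
  obtain ⟨v, hv, hKm⟩ := Nat.sInf_mem (h.image
    fun v => {w | w ∈ (cl G)^[m] S ∧ G.Adj v w}.ncard)
  rw [Km, ← hKm]
  obtain ⟨u, hu, huv⟩ := hv.2
  exact (Set.ncard_pos ((G.neighborSet v).toFinite.subset fun _ hw => hw.2)).2 ⟨u, hu, huv.symm⟩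

theorem le_Dm (hD : ∀ v, G.degree v ≤ D) {S : Set V} {m : ℕ} {v : V} (hv : v ∈ (cl G)^[m] S) :
    {w | w ∈ bdry G ((cl G)^[m] S) ∧ G.Adj v w}.ncard ≤ Dm G S m := by
  refine le_csSup ⟨D, ?_⟩ ⟨v, hv, rfl⟩
  rintro _ ⟨u, -, rfl⟩
  exact ncard_edge_fiber_le (E := {p | p.2 ∈ bdry G ((cl G)^[m] S) ∧ G.Adj p.1 p.2}) hD
    (fun _ hp => hp.2) u

theorem tsum_indicator_cl_le (hD : ∀ v, G.degree v ≤ D) (hf : Summable fun v => ‖f v‖ ^ 2)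
    (S : Set V) (m : ℕ) :
    ∑' v, ((cl G)^[m + 1] S).indicator (fun v => ‖f v‖ ^ 2) v ≤
      (2 * (Dm G S m : ℝ) / (Km G S m : ℝ) + 1) *
          ∑' v, ((cl G)^[m] S).indicator (fun v => ‖f v‖ ^ 2) v +
        1 / (Km G S m : ℝ) * (2 * pairEnergy G f) := by
  set T := (cl G)^[m] S with hT
  have hPE : 0 ≤ pairEnergy G f :=
    tsum_nonneg fun p => Set.indicator_nonneg (fun p _ => by positivity) p
  have hTsum : 0 ≤ ∑' v, T.indicator (fun v => ‖f v‖ ^ 2) v :=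
    tsum_nonneg fun v => Set.indicator_nonneg (fun v _ => by positivity) v
  have hsplit : ∑' v, ((cl G)^[m + 1] S).indicator (fun v => ‖f v‖ ^ 2) v =
      ∑' v, T.indicator (fun v => ‖f v‖ ^ 2) v +
        ∑' v, (bdry G T).indicator (fun v => ‖f v‖ ^ 2) v := by
    rw [Function.iterate_succ_apply', ← hT, cl, Set.indicator_union_of_disjoint
      (Set.disjoint_left.2 fun v hv hb => hb.1 hv)]
    exact (hf.indicator T).tsum_add (hf.indicator _)
  rw [hsplit]
  rcases (bdry G T).eq_empty_or_nonempty with hB | hB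
  · rw [hB]
    simp only [Set.indicator_empty, tsum_zero, add_zero]
    have h1 : 0 ≤ 2 * (Dm G S m : ℝ) / (Km G S m : ℝ) *
      ∑' v, T.indicator (fun v => ‖f v‖ ^ 2) v := by positivity
    have h2 : 0 ≤ 1 / (Km G S m : ℝ) * (2 * pairEnergy G f) := by positivity
    linarith
  · have hK : (0 : ℝ) < Km G S m := by exact_mod_cast Km_pos hB
    have h := mul_tsum_indicator_le hD hf (T := T) (B := bdry G T) (k := Km G S m)
      (d := Dm G S m) (fun v hv => Km_le hv) (fun v hv => le_Dm hD hv)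
    have h' := (le_div_iff₀' hK).2 h
    calc _ ≤ _ := add_le_add_right h' _
      _ = _ := by ring

theorem tsum_indicator_iterate_cl_le (hD : ∀ v, G.degree v ≤ D)
    (hf : Summable fun v => ‖f v‖ ^ 2) (S : Set V) (n : ℕ) :
    ∑' v, ((cl G)^[n] S).indicator (fun v => ‖f v‖ ^ 2) v ≤
      (∏ i ∈ Finset.range n, (2 * (Dm G S i : ℝ) / (Km G S i : ℝ) + 1)) *
          ∑' v, S.indicator (fun v => ‖f v‖ ^ 2) v +
        (∑ j ∈ Finset.range n, (1 / (Km G S j : ℝ)) *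
          ∏ i ∈ Finset.Ico (j + 1) n, (2 * (Dm G S i : ℝ) / (Km G S i : ℝ) + 1)) *
            (2 * pairEnergy G f) := by
  induction n with
  | zero => simp
  | succ m ih =>
    refine (tsum_indicator_cl_le hD hf S m).trans ?_
    have hc : 0 ≤ 2 * (Dm G S m : ℝ) / (Km G S m : ℝ) + 1 := by positivity
    have hsum : ∑ j ∈ Finset.range m, (1 / (Km G S j : ℝ)) *
          ∏ i ∈ Finset.Ico (j + 1) (m + 1), (2 * (Dm G S i : ℝ) / (Km G S i : ℝ) + 1) =
        (∑ j ∈ Finset.range m, (1 / (Km G S j : ℝ)) *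
          ∏ i ∈ Finset.Ico (j + 1) m, (2 * (Dm G S i : ℝ) / (Km G S i : ℝ) + 1)) *
            (2 * (Dm G S m : ℝ) / (Km G S m : ℝ) + 1) := by
      rw [Finset.sum_mul]
      refine Finset.sum_congr rfl fun j hj => ?_
      rw [Finset.prod_Ico_succ_top (Finset.mem_range.1 hj), mul_assoc]
    rw [Finset.prod_range_succ, Finset.sum_range_succ, hsum, Finset.Ico_self, Finset.prod_empty]
    calc _ ≤ _ := add_le_add_left (mul_le_mul_of_nonneg_left ih hc) _
      _ = _ := by ring

end Energy

theorem stmt4 [Countable V] (G : SimpleGraph V) [DecidableRel G.Adj] [G.LocallyFinite]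
    (hconn : G.Connected) (D : ℕ) (hD : ∀ v, G.degree v ≤ D)
    (S : Set V) (n : ℕ) (hn : 1 ≤ n)
    (hbd : (bdry G ((cl G)^[n - 1] S)).Nonempty)
    (f : V → ℂ) (hf : Memℓp f 2) :
    (Real.sqrt (∑' v : ((cl G)^[n] S : Set V), ‖f v‖ ^ 2) ≤
      Real.sqrt (∏ i ∈ Finset.range n, (2 * (Dm G S i : ℝ) / (Km G S i : ℝ) + 1)) *
        Real.sqrt (∑' v : S, ‖f v‖ ^ 2)
      + 2 * Real.sqrt (∑ j ∈ Finset.range n, (1 / (Km G S j : ℝ)) *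
          ∏ i ∈ Finset.Ico (j + 1) n, (2 * (Dm G S i : ℝ) / (Km G S i : ℝ) + 1)) *
        Real.sqrt (dirichlet G f)) ∧
    ((cl G)^[n] S = Set.univ →
      l2norm f ≤
        Real.sqrt (∏ i ∈ Finset.range n, (2 * (Dm G S i : ℝ) / (Km G S i : ℝ) + 1)) *
          Real.sqrt (∑' v : S, ‖f v‖ ^ 2)
        + 2 * Real.sqrt (∑ j ∈ Finset.range n, (1 / (Km G S j : ℝ)) *
            ∏ i ∈ Finset.Ico (j + 1) n, (2 * (Dm G S i : ℝ) / (Km G S i : ℝ) + 1)) *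
          Real.sqrt (dirichlet G f)) := by
  have hs : Summable fun v => ‖f v‖ ^ 2 := by
    simpa using hf.summable (by norm_num)
  have key : Real.sqrt (∑' v : ((cl G)^[n] S : Set V), ‖f v‖ ^ 2) ≤
      Real.sqrt (∏ i ∈ Finset.range n, (2 * (Dm G S i : ℝ) / (Km G S i : ℝ) + 1)) *
        Real.sqrt (∑' v : S, ‖f v‖ ^ 2)
      + 2 * Real.sqrt (∑ j ∈ Finset.range n, (1 / (Km G S j : ℝ)) *
          ∏ i ∈ Finset.Ico (j + 1) n, (2 * (Dm G S i : ℝ) / (Km G S i : ℝ) + 1)) *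
        Real.sqrt (dirichlet G f) := by
    have h := tsum_indicator_iterate_cl_le hD hs S n
    rw [pairEnergy_eq_two_mul_dirichlet hD hs, ← tsum_subtype, ← tsum_subtype] at h
    have hP : 0 ≤ ∏ i ∈ Finset.range n, (2 * (Dm G S i : ℝ) / (Km G S i : ℝ) + 1) :=
      Finset.prod_nonneg fun i _ => by positivity
    have hQ : 0 ≤ ∑ j ∈ Finset.range n, (1 / (Km G S j : ℝ)) *
        ∏ i ∈ Finset.Ico (j + 1) n, (2 * (Dm G S i : ℝ) / (Km G S i : ℝ) + 1) :=
      Finset.sum_nonneg fun j _ => mul_nonneg (by positivity)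
        (Finset.prod_nonneg fun i _ => by positivity)
    refine (Real.sqrt_le_sqrt h).trans ((sqrt_add_le_add_sqrt _ _).trans ?_)
    rw [Real.sqrt_mul hP, Real.sqrt_mul hQ, show 2 * (2 * dirichlet G f) = 2 ^ 2 * dirichlet G f by
      ring, Real.sqrt_mul (by positivity), Real.sqrt_sq (by norm_num)]
    exact le_of_eq (by ring)
  refine ⟨key, fun huniv => ?_⟩
  rw [huniv, tsum_univ fun v => ‖f v‖ ^ 2] at key
  exact key
end

section
/- Let S ⊂ V(G) be a subset of vertices such that every vertex v in bS is adjacent to at least K₀ ≥ 1 vertices of S, every vertex u ∈ S is adjacent to at most D₀ vertices of bS, and S ∪ bS = V(G). If 0 < ω < K₀/4, then for every f ∈ PW_ω(L): (Σ_{u∈S} |f(u)|²)^{1/2} ≤ ‖f‖ ≤ (1/(1−γ))·(2·D₀/K₀ + 1)^{1/2} · (Σ_{u∈S} |f(u)|²)^{1/2}, where γ = 2·√(ω/K₀) < 1. -/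
open scoped BigOperators

variable {V : Type*}

/-- The Paley–Wiener space `PW_ω(L)`: all `f ∈ L₂(G)` satisfying the Bernstein
inequality `‖L^k f‖ ≤ ω^k ‖f‖` for all `k ∈ ℕ`. -/
noncomputable def PW (G : SimpleGraph V) [DecidableRel G.Adj] [G.LocallyFinite] (ω : ℝ) :
    Set (V → ℂ) :=
  {f | Memℓp f 2 ∧ ∀ k : ℕ, l2norm ((lapl G)^[k] f) ≤ ω ^ k * l2norm f}

noncomputable def d0 (G : SimpleGraph V) (S : Set V) (u : V) : ℕ :=
  {w | w ∈ bdry G S ∧ G.Adj u w}.ncard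

lemma norm_sq_le_two_mul (z w : ℂ) : ‖z‖ ^ 2 ≤ 2 * ‖w‖ ^ 2 + 2 * ‖z - w‖ ^ 2 := by
  have h : ‖z‖ ≤ ‖w‖ + ‖z - w‖ := by simpa using norm_add_le w (z - w)
  nlinarith [norm_nonneg z, norm_nonneg w, norm_nonneg (z - w), sq_nonneg (‖w‖ - ‖z - w‖)]

lemma norm_sub_sq_le_two_mul (z w : ℂ) : ‖z - w‖ ^ 2 ≤ 2 * ‖z‖ ^ 2 + 2 * ‖w‖ ^ 2 := by
  nlinarith [norm_sub_le z w, norm_nonneg z, norm_nonneg w, norm_nonneg (z - w),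
    sq_nonneg (‖z‖ - ‖w‖)]

lemma norm_sub_sq_add_sub (z w : ℂ) :
    ‖z - w‖ ^ 2 + ‖z‖ ^ 2 - ‖w‖ ^ 2 = 2 * (starRingEnd ℂ z * (z - w)).re := by
  simp only [← Complex.normSq_eq_norm_sq, Complex.normSq_apply, Complex.mul_re, Complex.sub_re,
    Complex.sub_im, Complex.conj_re, Complex.conj_im]
  ring

lemma tsum_prod_adj_snd (G : SimpleGraph V) [DecidableRel G.Adj] (a : V → ℝ) :
    ∑' p : V × V, (if G.Adj p.1 p.2 then a p.2 else 0) =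
      ∑' p : V × V, (if G.Adj p.1 p.2 then a p.1 else 0) := by
  rw [← (Equiv.prodComm V V).tsum_eq]
  simp [G.adj_comm]

section Energy

variable (G : SimpleGraph V) [DecidableRel G.Adj] [G.LocallyFinite]

lemma tsum_ite_adj (v : V) (h : V → ℝ) :
    ∑' u, (if G.Adj v u then h u else 0) = ∑ u ∈ G.neighborFinset v, h u := by
  rw [tsum_eq_sum (s := G.neighborFinset v)]
  · exact Finset.sum_congr rfl fun u hu => if_pos (by simpa using hu)
  · intro u hu
    exact if_neg (by simpa using hu)

lemma summable_ite_adj (v : V) (h : V → ℝ) :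
    Summable fun u => if G.Adj v u then h u else 0 := by
  refine summable_of_ne_finset_zero (s := G.neighborFinset v) fun u hu => ?_
  exact if_neg (by simpa using hu)

lemma summable_prod_adj_fst {D : ℕ} (hD : ∀ v, G.degree v ≤ D) {a : V → ℝ}
    (ha0 : ∀ v, 0 ≤ a v) (ha : Summable a) :
    Summable fun p : V × V => if G.Adj p.1 p.2 then a p.1 else 0 := by
  rw [summable_prod_of_nonneg]
  · refine ⟨fun v => summable_ite_adj G v fun _ => a v, ?_⟩
    refine Summable.of_nonneg_of_le (fun v => tsum_nonneg fun u => ?_) (fun v => ?_)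
      (ha.mul_left (D : ℝ))
    · dsimp only
      split_ifs <;> simp [ha0]
    · rw [tsum_ite_adj G v fun _ => a v]
      simp only [Finset.sum_const, SimpleGraph.card_neighborFinset_eq_degree, nsmul_eq_mul]
      exact mul_le_mul_of_nonneg_right (by exact_mod_cast hD v) (ha0 v)
  · intro p
    dsimp only [Pi.zero_apply]
    split_ifs <;> simp [ha0]

lemma summable_prod_adj_snd {D : ℕ} (hD : ∀ v, G.degree v ≤ D) {a : V → ℝ}
    (ha0 : ∀ v, 0 ≤ a v) (ha : Summable a) :
    Summable fun p : V × V => if G.Adj p.1 p.2 then a p.2 else 0 := by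
  refine ((Equiv.prodComm V V).summable_iff.mpr (summable_prod_adj_fst G hD ha0 ha)).congr ?_
  intro p
  simp [G.adj_comm]

lemma summable_prod_adj_norm_sub_sq {D : ℕ} (hD : ∀ v, G.degree v ≤ D) {f : V → ℂ}
    (hf : Summable fun v => ‖f v‖ ^ 2) :
    Summable fun p : V × V => if G.Adj p.1 p.2 then ‖f p.1 - f p.2‖ ^ 2 else 0 := by
  refine Summable.of_nonneg_of_le (fun p => ?_) (fun p => ?_)
    (((summable_prod_adj_fst G hD (fun v => sq_nonneg ‖f v‖) hf).mul_left 2).add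
      ((summable_prod_adj_snd G hD (fun v => sq_nonneg ‖f v‖) hf).mul_left 2))
  · split_ifs <;> positivity
  · split_ifs
    · exact norm_sub_sq_le_two_mul _ _
    · simp

lemma summable_norm_lapl_sq {D : ℕ} (hD : ∀ v, G.degree v ≤ D) {f : V → ℂ}
    (hf : Summable fun v => ‖f v‖ ^ 2) : Summable fun v => ‖lapl G f v‖ ^ 2 := by
  refine Summable.of_nonneg_of_le (fun v => sq_nonneg _) (fun v => ?_)
    ((summable_prod_adj_norm_sub_sq G hD hf).prod.mul_left (D : ℝ))
  rw [tsum_ite_adj G v fun u => ‖f v - f u‖ ^ 2]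
  calc ‖lapl G f v‖ ^ 2
      ≤ (∑ u ∈ G.neighborFinset v, ‖f v - f u‖) ^ 2 := by
        gcongr
        exact norm_sum_le _ _
    _ ≤ (G.neighborFinset v).card * ∑ u ∈ G.neighborFinset v, ‖f v - f u‖ ^ 2 :=
        sq_sum_le_card_mul_sum_sq
    _ ≤ D * ∑ u ∈ G.neighborFinset v, ‖f v - f u‖ ^ 2 := by
        gcongr
        simpa using hD v

/-- The Dirichlet energy of `f`, with every edge counted twice, is at most `2 ‖f‖ ‖L f‖`. -/
lemma tsum_prod_adj_norm_sub_sq_le {D : ℕ} (hD : ∀ v, G.degree v ≤ D) {f : V → ℂ}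
    (hf : Summable fun v => ‖f v‖ ^ 2) :
    ∑' p : V × V, (if G.Adj p.1 p.2 then ‖f p.1 - f p.2‖ ^ 2 else 0) ≤
      2 * (l2norm f * l2norm (lapl G f)) := by
  have h1 := summable_prod_adj_fst G hD (fun v => sq_nonneg ‖f v‖) hf
  have h2 := summable_prod_adj_snd G hD (fun v => sq_nonneg ‖f v‖) hf
  have he := summable_prod_adj_norm_sub_sq G hD hf
  have hsum := (he.add h1).sub h2
  have htot := (he.add h1).tsum_sub h2
  rw [he.tsum_add h1, tsum_prod_adj_snd G fun v => ‖f v‖ ^ 2, add_sub_cancel_right] at htot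
  have hrow : ∀ v, ∑' u, ((if G.Adj v u then ‖f v - f u‖ ^ 2 else 0) +
      (if G.Adj v u then ‖f v‖ ^ 2 else 0) - (if G.Adj v u then ‖f u‖ ^ 2 else 0)) =
      2 * (starRingEnd ℂ (f v) * lapl G f v).re := by
    intro v
    rw [lapl, Finset.mul_sum, Complex.re_sum, Finset.mul_sum,
      ← tsum_ite_adj G v fun u => 2 * (starRingEnd ℂ (f v) * (f v - f u)).re]
    refine tsum_congr fun u => ?_
    split_ifs
    · exact norm_sub_sq_add_sub _ _
    · simp
  have hL := summable_norm_lapl_sq G hD hf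
  have hpq : Real.HolderConjugate 2 2 := Real.HolderConjugate.two_two
  obtain ⟨hm, hCS⟩ := Real.summable_and_inner_le_Lp_mul_Lq_tsum_of_nonneg hpq (f := fun v => ‖f v‖)
    (g := fun v => ‖lapl G f v‖) (fun v => norm_nonneg _) (fun v => norm_nonneg _)
    (by simpa using hf) (by simpa using hL)
  simp only [Real.rpow_two, ← Real.sqrt_eq_rpow] at hCS
  have hs := hsum.prod
  simp only [hrow] at hs
  rw [← htot, hsum.tsum_prod]
  simp only [hrow]
  calc ∑' v, 2 * (starRingEnd ℂ (f v) * lapl G f v).re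
      ≤ ∑' v, 2 * (‖f v‖ * ‖lapl G f v‖) := by
        refine hs.tsum_le_tsum (fun v => ?_) (hm.mul_left 2)
        have := Complex.re_le_norm (starRingEnd ℂ (f v) * lapl G f v)
        rw [norm_mul, Complex.norm_conj] at this
        linarith
    _ = 2 * ∑' v, ‖f v‖ * ‖lapl G f v‖ := tsum_mul_left
    _ ≤ _ := by
        gcongr
        exact hCS

/-- The mass of `f` off `S` is controlled by its mass on `S` and its Dirichlet energy. -/
lemma mul_tsum_compl_le {D : ℕ} (hD : ∀ v, G.degree v ≤ D) {S : Set V} {K₀ D₀ : ℕ}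
    (hKS : ∀ v ∈ bdry G S, K₀ ≤ {u | u ∈ S ∧ G.Adj v u}.ncard)
    (hDS : ∀ u ∈ S, d0 G S u ≤ D₀) (hcover : S ∪ bdry G S = Set.univ)
    {f : V → ℂ} (hf : Summable fun v => ‖f v‖ ^ 2) :
    K₀ * ∑' v, Sᶜ.indicator (fun v => ‖f v‖ ^ 2) v ≤
      2 * (D₀ * ∑' v, S.indicator (fun v => ‖f v‖ ^ 2) v) +
      2 * ∑' p : V × V, (if G.Adj p.1 p.2 then ‖f p.1 - f p.2‖ ^ 2 else 0) := by
  classical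
  have hb : ∀ v, v ∉ S → v ∈ bdry G S := fun v hv =>
    ((Set.ext_iff.mp hcover v).mpr trivial).resolve_left hv
  have he := summable_prod_adj_norm_sub_sq G hD hf
  set q : V × V → ℝ := fun p =>
    if G.Adj p.1 p.2 then (if p.1 ∉ S ∧ p.2 ∈ S then ‖f p.1‖ ^ 2 else 0) else 0 with hq
  set r : V × V → ℝ := fun p =>
    if G.Adj p.1 p.2 then (if p.1 ∉ S ∧ p.2 ∈ S then ‖f p.2‖ ^ 2 else 0) else 0 with hr
  have hqs : Summable q := by
    refine Summable.of_nonneg_of_le (fun p => ?_) (fun p => ?_)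
      (summable_prod_adj_fst G hD (fun v => sq_nonneg ‖f v‖) hf) <;>
    · simp only [hq]
      split_ifs <;> first | positivity | exact le_rfl
  have hrs : Summable r := by
    refine Summable.of_nonneg_of_le (fun p => ?_) (fun p => ?_)
      (summable_prod_adj_snd G hD (fun v => sq_nonneg ‖f v‖) hf) <;>
    · simp only [hr]
      split_ifs <;> first | positivity | exact le_rfl
  have hqr : ∑' p, q p ≤ 2 * ∑' p, r p +
      2 * ∑' p : V × V, (if G.Adj p.1 p.2 then ‖f p.1 - f p.2‖ ^ 2 else 0) := by
    rw [← tsum_mul_left, ← tsum_mul_left, ← (hrs.mul_left 2).tsum_add (he.mul_left 2)]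
    refine hqs.tsum_le_tsum (fun p => ?_) ((hrs.mul_left 2).add (he.mul_left 2))
    simp only [hq, hr]
    split_ifs
    · exact norm_sq_le_two_mul _ _
    · positivity
    · simp
  have hleft : K₀ * ∑' v, Sᶜ.indicator (fun v => ‖f v‖ ^ 2) v ≤ ∑' p, q p := by
    rw [hqs.tsum_prod, ← tsum_mul_left]
    refine ((hf.indicator Sᶜ).mul_left _).tsum_le_tsum (fun v => ?_) hqs.prod
    simp only [hq]
    rw [tsum_ite_adj G v fun u => if v ∉ S ∧ u ∈ S then ‖f v‖ ^ 2 else 0]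
    by_cases hv : v ∈ S
    · simp [hv]
    · have hcard := hKS v (hb v hv)
      have hset : {u | u ∈ S ∧ G.Adj v u} = ((G.neighborFinset v).filter (· ∈ S) : Finset V) := by
        ext u
        simp [and_comm]
      rw [hset, Set.ncard_coe_finset] at hcard
      simp only [hv, not_false_eq_true, true_and, ← Finset.sum_filter, Finset.sum_const,
        nsmul_eq_mul, Set.indicator_of_mem (Set.mem_compl hv)]
      gcongr
  have hright : ∑' p, r p ≤ D₀ * ∑' v, S.indicator (fun v => ‖f v‖ ^ 2) v := by
    have hrs' : Summable (r ∘ Prod.swap) := (Equiv.prodComm V V).summable_iff.mpr hrs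
    have : ∑' p, r p = ∑' p, (r ∘ Prod.swap) p := ((Equiv.prodComm V V).tsum_eq r).symm
    rw [this, hrs'.tsum_prod, ← tsum_mul_left]
    refine hrs'.prod.tsum_le_tsum (fun u => ?_) ((hf.indicator S).mul_left _)
    simp only [hr, Function.comp_apply, Prod.swap_prod_mk, G.adj_comm _ u]
    rw [tsum_ite_adj G u fun v => if v ∉ S ∧ u ∈ S then ‖f u‖ ^ 2 else 0]
    by_cases hu : u ∈ S
    · have hcard := hDS u hu
      have hset : {w | w ∈ bdry G S ∧ G.Adj u w} =
          ((G.neighborFinset u).filter (· ∉ S) : Finset V) := by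
        ext w
        simp only [Set.mem_ofPred_eq, Finset.coe_filter, SimpleGraph.mem_neighborFinset]
        exact ⟨fun h => ⟨h.2, h.1.1⟩, fun h => ⟨hb w h.2, h.1⟩⟩
      rw [d0, hset, Set.ncard_coe_finset] at hcard
      simp only [hu, and_true, ← Finset.sum_filter, Finset.sum_const,
        nsmul_eq_mul, Set.indicator_of_mem hu]
      gcongr
    · simp [hu]
  linarith

end Energy

theorem stmt10 [Countable V] (G : SimpleGraph V) [DecidableRel G.Adj] [G.LocallyFinite]
    (hconn : G.Connected) (D : ℕ) (hD : ∀ v, G.degree v ≤ D)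
    (S : Set V) (K₀ D₀ : ℕ) (hK : 1 ≤ K₀)
    (hKS : ∀ v ∈ bdry G S, K₀ ≤ {u | u ∈ S ∧ G.Adj v u}.ncard)
    (hDS : ∀ u ∈ S, d0 G S u ≤ D₀)
    (hcover : S ∪ bdry G S = Set.univ)
    (ω : ℝ) (hω : 0 < ω) (hωsmall : ω < (K₀ : ℝ) / 4)
    (f : V → ℂ) (hf : f ∈ PW G ω)
    (γ : ℝ) (hγ : γ = 2 * Real.sqrt (ω / (K₀ : ℝ))) :
    γ < 1 ∧
    Real.sqrt (∑' u : S, ‖f u‖ ^ 2) ≤ l2norm f ∧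
    l2norm f ≤ (1 / (1 - γ)) * Real.sqrt (2 * (D₀ : ℝ) / (K₀ : ℝ) + 1) *
      Real.sqrt (∑' u : S, ‖f u‖ ^ 2) := by
  obtain ⟨hmem, hPW⟩ := hf
  have hs : Summable fun v => ‖f v‖ ^ 2 := by
    simpa using hmem.summable (by norm_num)
  have hK0 : (0 : ℝ) < K₀ := by exact_mod_cast hK
  have hγ0 : 0 ≤ γ := by rw [hγ]; positivity
  have hγsq : γ ^ 2 * K₀ = 4 * ω := by
    rw [hγ, mul_pow, Real.sq_sqrt (by positivity)]
    field_simp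
    norm_num
  have hγ1 : γ < 1 := by
    by_contra! h
    nlinarith [mul_le_mul_of_nonneg_right (one_le_pow₀ h (n := 2)) hK0.le]
  have hsplit := (hs.indicator S).tsum_add (hs.indicator Sᶜ)
  simp only [Set.indicator_self_add_compl_apply] at hsplit
  have hmain := mul_tsum_compl_le G hD hKS hDS hcover hs
  have henergy := tsum_prod_adj_norm_sub_sq_le G hD hs
  have hL : l2norm (lapl G f) ≤ ω * l2norm f := by simpa using hPW 1
  have hN0 : 0 ≤ l2norm f := Real.sqrt_nonneg _
  have hNsq : l2norm f ^ 2 = ∑' v, ‖f v‖ ^ 2 :=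
    Real.sq_sqrt (tsum_nonneg fun v => sq_nonneg _)
  have hS0 : 0 ≤ ∑' v, S.indicator (fun v => ‖f v‖ ^ 2) v :=
    tsum_nonneg fun v => Set.indicator_nonneg (fun _ _ => sq_nonneg _) v
  have hC0 : 0 ≤ ∑' v, Sᶜ.indicator (fun v => ‖f v‖ ^ 2) v :=
    tsum_nonneg fun v => Set.indicator_nonneg (fun _ _ => sq_nonneg _) v
  rw [tsum_subtype S fun v => ‖f v‖ ^ 2]
  refine ⟨hγ1, Real.sqrt_le_sqrt (by linarith), ?_⟩
  set A := ∑' v, S.indicator (fun v => ‖f v‖ ^ 2) v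
  set N := l2norm f
  have hbound : N ^ 2 ≤ (2 * D₀ / K₀ + 1) * A + (γ * N) ^ 2 := by
    have hNL : N * l2norm (lapl G f) ≤ N * (ω * N) := mul_le_mul_of_nonneg_left hL hN0
    have hKN : K₀ * N ^ 2 ≤ K₀ * ((2 * D₀ / K₀ + 1) * A + (γ * N) ^ 2) := by
      have : K₀ * ((2 * D₀ / K₀ + 1) * A + (γ * N) ^ 2) =
          2 * D₀ * A + K₀ * A + (γ ^ 2 * K₀) * N ^ 2 := by
        field_simp
      have hKsplit := congrArg ((K₀ : ℝ) * ·) (hNsq.trans hsplit)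
      simp only [mul_add] at hKsplit
      rw [this, hγsq]
      linarith
    exact le_of_mul_le_mul_left hKN hK0
  have hroot : N ≤ Real.sqrt (2 * D₀ / K₀ + 1) * Real.sqrt A + γ * N := by
    rw [← Real.sqrt_mul (by positivity)]
    refine (sq_le_sq₀ hN0 (by positivity)).mp ?_
    have := Real.sq_sqrt (show 0 ≤ (2 * D₀ / K₀ + 1) * A by positivity)
    nlinarith [mul_nonneg (Real.sqrt_nonneg ((2 * D₀ / K₀ + 1) * A)) (mul_nonneg hγ0 hN0)]
  rw [mul_assoc, one_div, inv_mul_eq_div, le_div_iff₀ (by linarith)]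
  linarith
end
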